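/- Let ε > 0, a ≤ b, and K ≥ 0 be real numbers. Let F : [a,b] × [0,ε] → [0,∞) be jointly measurable such that for each y ∈ [a,b] the function u ↦ F(y,u) is continuous, and let G : [a,b] × [0,ε] → [0,∞) be measurable with ∫₀^ε ∫ₐᵇ G(y,u)² dy du < ∞. Assume that for every (y,u) ∈ [a,b] × [0,ε] one has F(y,u) ≤ K·(F(y,0) + ∫₀^u G(y,v) dv). Then ∫ₐᵇ (sup_{u ∈ [0,ε]} F(y,u))² dy ≤ 2K² · ( ∫ₐᵇ F(y,0)² dy + ε · ∫₀^ε ∫ₐᵇ G(y,u)² dy du ). -/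

import Mathlib

open MeasureTheory Set

/-- Cauchy-Schwarz against the constant function `1`. -/
lemma lintegral_sq_le_measure_univ_mul_lintegral_sq {α : Type*} [MeasurableSpace α]
    (μ : Measure α) {f : α → ENNReal} (hf : AEMeasurable f μ) :
    (∫⁻ x, f x ∂μ) ^ 2 ≤ μ univ * ∫⁻ x, f x ^ 2 ∂μ := by
  have h := ENNReal.lintegral_mul_le_Lp_mul_Lq μ Real.HolderConjugate.two_two
    (aemeasurable_const (b := (1 : ENNReal))) hf
  simp only [Pi.mul_apply, one_mul, one_pow, lintegral_const,
    ENNReal.rpow_two] at h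
  have hsq : ∀ t : ENNReal, (t ^ (1 / 2 : ℝ)) ^ 2 = t := fun t => by
    rw [← ENNReal.rpow_two, ← ENNReal.rpow_mul]; norm_num
  calc (∫⁻ x, f x ∂μ) ^ 2 ≤ _ := pow_le_pow_left' h 2
    _ = _ := by rw [mul_pow, hsq, hsq]

/-- Scalar content of Lemma 4.5: a pointwise evolution bound
`F(y,u) ≤ K (F(y,0) + ∫₀ᵘ G(y,v) dv)` implies a square-integrated bound on the
supremum of `F(y,·)` over `[0,ε]`, with a loss of one factor of `ε` on the source. -/
theorem sup_square_integral_evolution_bound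
    (ε a b K : ℝ) (hε : 0 < ε) (hab : a ≤ b) (hK : 0 ≤ K)
    (F G : ℝ → ℝ → ℝ)
    (hF_meas : Measurable (Function.uncurry F))
    (hF_nonneg : ∀ y ∈ Icc a b, ∀ u ∈ Icc (0:ℝ) ε, 0 ≤ F y u)
    (hF_cont : ∀ y ∈ Icc a b, ContinuousOn (F y) (Icc (0:ℝ) ε))
    (hG_meas : Measurable (Function.uncurry G))
    (hG_nonneg : ∀ y ∈ Icc a b, ∀ u ∈ Icc (0:ℝ) ε, 0 ≤ G y u)
    (hG_fin : (∫⁻ u in Icc (0:ℝ) ε, ∫⁻ y in Icc a b, ENNReal.ofReal ((G y u)^2)) < ⊤)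
    (hbound : ∀ y ∈ Icc a b, ∀ u ∈ Icc (0:ℝ) ε,
      ENNReal.ofReal (F y u) ≤ ENNReal.ofReal K *
        (ENNReal.ofReal (F y 0) + ∫⁻ v in Icc (0:ℝ) u, ENNReal.ofReal (G y v))) :
    (∫⁻ y in Icc a b, ENNReal.ofReal ((sSup (F y '' Icc (0:ℝ) ε))^2))
      ≤ ENNReal.ofReal (2 * K^2) *
        ((∫⁻ y in Icc a b, ENNReal.ofReal ((F y 0)^2))
          + ENNReal.ofReal ε *
            ∫⁻ u in Icc (0:ℝ) ε, ∫⁻ y in Icc a b, ENNReal.ofReal ((G y u)^2)) := by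
  have hG_meas' : Measurable fun p : ℝ × ℝ => ENNReal.ofReal (G p.1 p.2 ^ 2) :=
    (hG_meas.pow_const 2).ennreal_ofReal
  have hpt : ∀ y ∈ Icc a b, ENNReal.ofReal ((sSup (F y '' Icc (0:ℝ) ε)) ^ 2) ≤
      ENNReal.ofReal (2 * K ^ 2) * (ENNReal.ofReal ((F y 0) ^ 2) +
        ENNReal.ofReal ε * ∫⁻ u in Icc (0:ℝ) ε, ENNReal.ofReal ((G y u) ^ 2)) := by
    intro y hy
    obtain ⟨u, hu, hsup⟩ :=
      isCompact_Icc.exists_sSup_image_eq (nonempty_Icc.2 hε.le) (hF_cont y hy)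
    have hGy : Measurable fun u => ENNReal.ofReal (G y u) :=
      (hG_meas.comp measurable_prodMk_left).ennreal_ofReal
    have hCS := lintegral_sq_le_measure_univ_mul_lintegral_sq
      (volume.restrict (Icc (0:ℝ) ε)) hGy.aemeasurable
    rw [Measure.restrict_apply_univ, Real.volume_Icc, sub_zero,
      setLIntegral_congr_fun (g := fun u => ENNReal.ofReal (G y u ^ 2)) measurableSet_Icc
        fun v hv => (ENNReal.ofReal_pow (hG_nonneg y hy v hv) 2).symm] at hCS
    rw [hsup, ENNReal.ofReal_pow (hF_nonneg y hy u hu),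
      ENNReal.ofReal_pow (hF_nonneg y hy 0 ⟨le_rfl, hε.le⟩)]
    calc ENNReal.ofReal (F y u) ^ 2
        ≤ (ENNReal.ofReal K * (ENNReal.ofReal (F y 0) +
            ∫⁻ v in Icc (0:ℝ) ε, ENNReal.ofReal (G y v))) ^ 2 := by
          gcongr
          refine (hbound y hy u hu).trans ?_
          gcongr
          exact hu.2
      _ ≤ ENNReal.ofReal K ^ 2 * (2 * (ENNReal.ofReal (F y 0) ^ 2 +
            (∫⁻ v in Icc (0:ℝ) ε, ENNReal.ofReal (G y v)) ^ 2)) := by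
          rw [mul_pow]
          gcongr
          have h := ENNReal.rpow_add_le_mul_rpow_add_rpow (ENNReal.ofReal (F y 0))
            (∫⁻ v in Icc (0:ℝ) ε, ENNReal.ofReal (G y v)) one_le_two
          norm_num at h
          exact h
      _ = ENNReal.ofReal (2 * K ^ 2) * (ENNReal.ofReal (F y 0) ^ 2 +
            (∫⁻ v in Icc (0:ℝ) ε, ENNReal.ofReal (G y v)) ^ 2) := by
          rw [ENNReal.ofReal_mul zero_le_two, ENNReal.ofReal_pow hK, ENNReal.ofReal_ofNat]
          ring
      _ ≤ _ := by gcongr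
  have hF0 : Measurable fun y => ENNReal.ofReal ((F y 0) ^ 2) :=
    ((hF_meas.comp measurable_prodMk_right).pow_const 2).ennreal_ofReal
  refine (setLIntegral_mono' measurableSet_Icc hpt).trans_eq ?_
  rw [lintegral_const_mul' _ _ ENNReal.ofReal_ne_top, lintegral_add_left hF0,
    lintegral_const_mul' _ _ ENNReal.ofReal_ne_top,
    lintegral_lintegral_swap hG_meas'.aemeasurable]
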